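/- arXiv:2309.06427 — 2 statements merged into one kernel-verified Lean document; each statement's English description precedes it below -/
import Mathlib

section
/- Let S be a symmetric block tridiagonal matrix all of whose diagonal blocks are invertible. If u ≠ 0 is a vector supported on blocks of even index (u = u_o) with Ψr⁻¹ * Pr *ᵥ u = 0, then Φadd⁻¹ * S *ᵥ u = u; that is, (1, u) is an eigenpair of Φadd⁻¹ * S. -/
open Matrix

namespace StairPrecond

/-- Real matrices indexed as n×n arrays of m×m blocks. -/
abbrev Mat (n m : ℕ) := Matrix (Fin n × Fin m) (Fin n × Fin m) ℝ

/-- Vectors compatible with `Mat n m`. -/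
abbrev Vec (n m : ℕ) := Fin n × Fin m → ℝ

/-- The (i,j)-block of a block matrix. -/
def blockOf {n m : ℕ} (M : Mat n m) (i j : Fin n) : Matrix (Fin m) (Fin m) ℝ :=
  fun a b => M (i, a) (j, b)

/-- A matrix is block tridiagonal if its (i,j)-block vanishes whenever |i - j| > 1. -/
def IsBlockTridiag {n m : ℕ} (M : Mat n m) : Prop :=
  ∀ i j : Fin n, (i.val + 1 < j.val ∨ j.val + 1 < i.val) → blockOf M i j = 0

/-- The block-diagonal part `D` of a matrix: keep only the diagonal blocks. -/
def blockDiagPart {n m : ℕ} (M : Mat n m) : Mat n m :=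
  fun p q => if p.1 = q.1 then M p q else 0

/-- The left stair Ψl: diagonal blocks everywhere, off-diagonal blocks only in
block rows of odd index (0-indexed). -/
def stairL {n m : ℕ} (M : Mat n m) : Mat n m :=
  fun p q =>
    if p.1 = q.1 ∨ (Odd p.1.val ∧ (p.1.val = q.1.val + 1 ∨ q.1.val = p.1.val + 1)) then M p q
    else 0

/-- The right stair Ψr: diagonal blocks everywhere, off-diagonal blocks only in
block rows of even index (0-indexed). -/
def stairR {n m : ℕ} (M : Mat n m) : Mat n m :=
  fun p q =>
    if p.1 = q.1 ∨ (Even p.1.val ∧ (p.1.val = q.1.val + 1 ∨ q.1.val = p.1.val + 1)) then M p q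
    else 0

/-- Pl = Ψl − S. -/
def Pl {n m : ℕ} (S : Mat n m) : Mat n m := stairL S - S

/-- Pr = Ψr − S. -/
def Pr {n m : ℕ} (S : Mat n m) : Mat n m := stairR S - S

/-- The additive stair preconditioner Φadd⁻¹ = (1/2) • (Ψl⁻¹ + Ψr⁻¹). -/
noncomputable def Phiadd {n m : ℕ} (S : Mat n m) : Mat n m :=
  (1 / 2 : ℝ) • ((stairL S)⁻¹ + (stairR S)⁻¹)

/-- The symmetric stair preconditioner Φsym⁻¹ = Ψl⁻¹ + Ψr⁻¹ − D⁻¹. -/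
noncomputable def Phisym {n m : ℕ} (S : Mat n m) : Mat n m :=
  (stairL S)⁻¹ + (stairR S)⁻¹ - (blockDiagPart S)⁻¹

/-- All diagonal blocks are invertible m×m matrices. -/
def DiagBlocksInvertible {n m : ℕ} (M : Mat n m) : Prop :=
  ∀ i : Fin n, IsUnit (blockOf M i i)

/-- v_e : the part of v supported on blocks of odd index (0-indexed). -/
def vE {n m : ℕ} (v : Vec n m) : Vec n m := fun p => if Odd p.1.val then v p else 0

/-- v_o : the part of v supported on blocks of even index (0-indexed). -/
def vO {n m : ℕ} (v : Vec n m) : Vec n m := fun p => if Even p.1.val then v p else 0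

/-- A stair matrix: block tridiagonal, with off-diagonal blocks nonzero only in
block rows of a fixed parity (a left stair has them only in odd-indexed rows,
a right stair only in even-indexed rows, 0-indexed). -/
def IsStairMatrix {n m : ℕ} (Ψ : Mat n m) : Prop :=
  IsBlockTridiag Ψ ∧
    ((∀ i j : Fin n, i ≠ j → Even i.val → blockOf Ψ i j = 0) ∨
     (∀ i j : Fin n, i ≠ j → Odd i.val → blockOf Ψ i j = 0))

lemma blockOf_mulVec_eq {n m : ℕ} (M : Mat n m) (v : Vec n m) (i : Fin n)
    (h : ∀ j, j ≠ i → ∀ a b, M (i, a) (j, b) * v (j, b) = 0) (a : Fin m) :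
    (blockOf M i i *ᵥ fun b => v (i, b)) a = (M *ᵥ v) (i, a) := by
  simp only [mulVec, dotProduct, Fintype.sum_prod_type, blockOf]
  rw [Finset.sum_eq_single i (fun j _ hj => Finset.sum_eq_zero fun b _ => h j hj a b)
    (by simp)]

/-- A block matrix with invertible diagonal blocks is invertible if its off-diagonal blocks
only couple block rows satisfying `P` to block columns not satisfying `P`. -/
lemma isUnit_of_coupling {n m : ℕ} (M : Mat n m) (P : Fin n → Prop)
    (hM : DiagBlocksInvertible M)
    (hP : ∀ i j, j ≠ i → ¬ (P i ∧ ¬ P j) → ∀ a b, M (i, a) (j, b) = 0) : IsUnit M := by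
  rw [← mulVec_injective_iff_isUnit, ← coe_mulVecLin, injective_iff_map_eq_zero]
  intro v hv
  rw [mulVecLin_apply] at hv
  have key (i : Fin n) (h : ∀ j, j ≠ i → ∀ a b, M (i, a) (j, b) * v (j, b) = 0) (b : Fin m) :
      v (i, b) = 0 := by
    have hz : blockOf M i i *ᵥ (fun b => v (i, b)) = blockOf M i i *ᵥ 0 := by
      ext a
      rw [blockOf_mulVec_eq M v i h, hv, mulVec_zero]
      rfl
    exact congrFun (mulVec_injective_of_isUnit (hM i) hz) b
  have hnot (i : Fin n) (hi : ¬ P i) (b : Fin m) : v (i, b) = 0 :=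
    key i (fun j hj a b => by rw [hP i j hj (by tauto), zero_mul]) b
  ext ⟨i, b⟩
  refine key i (fun j hj a b => ?_) b
  by_cases hPj : P j
  · rw [hP i j hj (by tauto), zero_mul]
  · rw [hnot j hPj, mul_zero]

lemma isUnit_stairL {n m : ℕ} {S : Mat n m} (hdiag : DiagBlocksInvertible S) :
    IsUnit (stairL S) := by
  refine isUnit_of_coupling _ (fun i => Odd i.val) (fun i => ?_) fun i j hj h a b => ?_
  · have h : blockOf (stairL S) i i = blockOf S i i := by
      ext a b
      simp [blockOf, stairL]
    rw [h]
    exact hdiag i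
  · refine if_neg ?_
    grind

lemma isUnit_stairR {n m : ℕ} {S : Mat n m} (hdiag : DiagBlocksInvertible S) :
    IsUnit (stairR S) := by
  refine isUnit_of_coupling _ (fun i => Even i.val) (fun i => ?_) fun i j hj h a b => ?_
  · have h : blockOf (stairR S) i i = blockOf S i i := by
      ext a b
      simp [blockOf, stairR]
    rw [h]
    exact hdiag i
  · refine if_neg ?_
    grind

lemma stairL_mulVec_of_odd_eq_zero {n m : ℕ} {S : Mat n m} (htri : IsBlockTridiag S)
    {u : Vec n m} (hsupp : ∀ p : Fin n × Fin m, Odd p.1.val → u p = 0) :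
    stairL S *ᵥ u = S *ᵥ u := by
  ext ⟨i, a⟩
  refine Finset.sum_congr rfl fun ⟨j, b⟩ _ => ?_
  by_cases hj : Odd j.val
  · simp [hsupp (j, b) hj]
  · by_cases hfar : i.val + 1 < j.val ∨ j.val + 1 < i.val
    · have hz : S (i, a) (j, b) = 0 := congrFun₂ (htri i j hfar) a b
      simp [stairL, hz]
    · have hmem : i = j ∨ (Odd i.val ∧ (i.val = j.val + 1 ∨ j.val = i.val + 1)) := by grind
      simp only [stairL, if_pos hmem]

/-- If u ≠ 0 is supported on blocks of even index and Ψr⁻¹ * Pr *ᵥ u = 0, then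
(1, u) is an eigenpair of Φadd⁻¹ * S. -/
theorem add_eigenpair_one_of_right_kernel {n m : ℕ} (hn : 0 < n) (hm : 0 < m)
    (S : Mat n m) (hsymm : S.IsSymm) (htri : IsBlockTridiag S)
    (hdiag : DiagBlocksInvertible S)
    (u : Vec n m) (hu : u ≠ 0)
    (hsupp : ∀ p : Fin n × Fin m, Odd p.1.val → u p = 0)
    (hker : ((stairR S)⁻¹ * Pr S) *ᵥ u = 0) :
    (Phiadd S * S) *ᵥ u = u := by
  have hL : (stairL S)⁻¹ *ᵥ (S *ᵥ u) = u := by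
    rw [← stairL_mulVec_of_odd_eq_zero htri hsupp, mulVec_mulVec,
      nonsing_inv_mul _ ((isUnit_iff_isUnit_det _).mp (isUnit_stairL hdiag)), one_mulVec]
  have hR : (stairR S)⁻¹ *ᵥ (S *ᵥ u) = u := by
    rw [Pr, mul_sub, nonsing_inv_mul _ ((isUnit_iff_isUnit_det _).mp (isUnit_stairR hdiag)),
      sub_mulVec, one_mulVec, sub_eq_zero] at hker
    rw [mulVec_mulVec, ← hker]
  rw [Phiadd, ← mulVec_mulVec, smul_mulVec, add_mulVec, hL, hR, ← two_smul ℝ u, smul_smul]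
  norm_num

end StairPrecond
end

section
/- If S is a symmetric block tridiagonal matrix that is positive definite, then the additive stair preconditioner Φadd⁻¹ = (1/2) • (Ψl⁻¹ + Ψr⁻¹) is a symmetric positive definite matrix. -/
open Matrix

namespace StairPrecond

/-- Closed form of the inverse of `D + A` when `A * D⁻¹ * A = 0`; the latter is ensured by a
matrix `J` commuting with `D` that acts on `A` as `1` from the right and as `-1` from the left. -/
lemma inv_add_of_sign {ι : Type*} [Fintype ι] [DecidableEq ι] {D A J : Matrix ι ι ℝ}
    (hD : IsUnit D.det) (hJD : J * D = D * J) (hAJ : A * J = A) (hJA : J * A = -A) :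
    (D + A)⁻¹ = D⁻¹ - D⁻¹ * A * D⁻¹ := by
  have hJi : J * D⁻¹ = D⁻¹ * J := by
    calc J * D⁻¹ = D⁻¹ * (D * J) * D⁻¹ := by rw [nonsing_inv_mul_cancel_left _ _ hD]
      _ = D⁻¹ * J := by
        rw [← hJD, ← Matrix.mul_assoc, mul_nonsing_inv_cancel_right _ _ hD]
  have hzero : A * D⁻¹ * A = 0 := by
    have h : A * D⁻¹ * A = -(A * D⁻¹ * A) := by
      calc A * D⁻¹ * A = A * (J * D⁻¹) * A := by rw [← Matrix.mul_assoc, hAJ]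
        _ = A * D⁻¹ * (J * A) := by rw [hJi]; simp only [Matrix.mul_assoc]
        _ = -(A * D⁻¹ * A) := by rw [hJA, Matrix.mul_neg]
    ext i j
    exact self_eq_neg.mp (congrFun (congrFun h i) j)
  refine inv_eq_right_inv ?_
  have h : (D + A) * (D⁻¹ - D⁻¹ * A * D⁻¹)
      = D * D⁻¹ - D * D⁻¹ * A * D⁻¹ + A * D⁻¹ - A * D⁻¹ * A * D⁻¹ := by noncomm_ring
  rw [h, hzero, mul_nonsing_inv _ hD]
  simp

/-- The diagonal matrix whose sign alternates with the parity of the block index. -/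
def blockSign (n m : ℕ) : Mat n m := diagonal fun p => (-1) ^ p.1.val

lemma blockSign_mul_self (n m : ℕ) : blockSign n m * blockSign n m = 1 := by
  simp [blockSign, ← mul_pow]

lemma blockSign_mul_blockDiagPart {n m : ℕ} (S : Mat n m) :
    blockSign n m * blockDiagPart S = blockDiagPart S * blockSign n m := by
  ext p q
  by_cases h : p.1 = q.1 <;> simp [blockSign, blockDiagPart, h, mul_comm]

lemma stairL_sub_mul_blockSign {n m : ℕ} (S : Mat n m) :
    (stairL S - blockDiagPart S) * blockSign n m = stairL S - blockDiagPart S := by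
  ext p q
  simp only [blockSign, mul_diagonal, Matrix.sub_apply, stairL, blockDiagPart]
  by_cases h : p.1 = q.1
  · simp [h]
  by_cases h' : Odd p.1.val ∧ (p.1.val = q.1.val + 1 ∨ q.1.val = p.1.val + 1)
  · have hq : Even q.1.val := by grind
    simp [hq.neg_one_pow]
  · simp [h, h']

lemma blockSign_mul_stairL_sub {n m : ℕ} (S : Mat n m) :
    blockSign n m * (stairL S - blockDiagPart S) = -(stairL S - blockDiagPart S) := by
  ext p q
  simp only [blockSign, diagonal_mul, Matrix.sub_apply, Matrix.neg_apply, stairL, blockDiagPart]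
  by_cases h : p.1 = q.1
  · simp [h]
  by_cases hp : Odd p.1.val
  · simp [hp.neg_one_pow]
  · simp [h, hp]

lemma stairR_sub_mul_blockSign {n m : ℕ} (S : Mat n m) :
    (stairR S - blockDiagPart S) * blockSign n m = -(stairR S - blockDiagPart S) := by
  ext p q
  simp only [blockSign, mul_diagonal, Matrix.sub_apply, Matrix.neg_apply, stairR, blockDiagPart]
  by_cases h : p.1 = q.1
  · simp [h]
  by_cases h' : Even p.1.val ∧ (p.1.val = q.1.val + 1 ∨ q.1.val = p.1.val + 1)
  · have hq : Odd q.1.val := by grind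
    simp [hq.neg_one_pow]
  · simp [h, h']

lemma blockSign_mul_stairR_sub {n m : ℕ} (S : Mat n m) :
    blockSign n m * (stairR S - blockDiagPart S) = stairR S - blockDiagPart S := by
  ext p q
  simp only [blockSign, diagonal_mul, Matrix.sub_apply, stairR, blockDiagPart]
  by_cases h : p.1 = q.1
  · simp [h]
  by_cases hp : Even p.1.val
  · simp [hp.neg_one_pow]
  · simp [h, hp]

lemma stairL_add_stairR {n m : ℕ} {S : Mat n m} (htri : IsBlockTridiag S) :
    stairL S + stairR S = S + blockDiagPart S := by
  ext p q
  simp only [Matrix.add_apply, stairL, stairR, blockDiagPart]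
  by_cases h : p.1 = q.1
  · simp [h]
  by_cases h' : p.1.val = q.1.val + 1 ∨ q.1.val = p.1.val + 1
  · rcases Nat.even_or_odd p.1.val with hp | hp
    · simp [h, h', hp, Nat.not_odd_iff_even.mpr hp]
    · simp [h, h', hp, Nat.not_even_iff_odd.mpr hp]
  · have hne : p.1.val ≠ q.1.val := fun e => h (Fin.ext e)
    have hz : S p q = 0 := congrFun (congrFun (htri p.1 q.1 (by omega)) p.2) q.2
    simp [h, h', hz]

lemma blockSign_conj {n m : ℕ} {S : Mat n m} (htri : IsBlockTridiag S) :
    blockSign n m * S * blockSign n m = (2 : ℝ) • blockDiagPart S - S := by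
  have hS : S = blockDiagPart S + (stairL S - blockDiagPart S)
      + (stairR S - blockDiagPart S) := by
    calc S = stairL S + stairR S - blockDiagPart S :=
          eq_sub_of_add_eq (stairL_add_stairR htri).symm
      _ = _ := by abel
  have h : blockSign n m * S * blockSign n m = blockDiagPart S
      - (stairL S - blockDiagPart S) - (stairR S - blockDiagPart S) := by
    conv_lhs => rw [hS]
    rw [Matrix.mul_add, Matrix.mul_add, Matrix.add_mul, Matrix.add_mul,
      blockSign_mul_blockDiagPart, blockSign_mul_stairL_sub, blockSign_mul_stairR_sub,
      Matrix.neg_mul, stairL_sub_mul_blockSign, stairR_sub_mul_blockSign, Matrix.mul_assoc,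
      blockSign_mul_self, Matrix.mul_one]
    abel
  calc blockSign n m * S * blockSign n m
      = blockDiagPart S + blockDiagPart S + blockDiagPart S - (stairL S + stairR S) := by
        rw [h]; abel
    _ = (2 : ℝ) • blockDiagPart S - S := by rw [stairL_add_stairR htri, two_smul]; abel

lemma posDef_blockSign_conj {n m : ℕ} {S : Mat n m} (hpd : S.PosDef) :
    (blockSign n m * S * blockSign n m).PosDef := by
  have hJ : IsUnit (blockSign n m) := .of_mul_eq_one _ (blockSign_mul_self n m)
  have hH : star (blockSign n m) = blockSign n m := by
    simp [blockSign, star_eq_conjTranspose]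
  have := (hJ.posDef_star_left_conjugate_iff (x := S)).mpr hpd
  rwa [hH] at this

lemma posDef_blockDiagPart {n m : ℕ} {S : Mat n m} (htri : IsBlockTridiag S)
    (hpd : S.PosDef) : (blockDiagPart S).PosDef := by
  have h : blockDiagPart S = (1 / 2 : ℝ) • (S + blockSign n m * S * blockSign n m) := by
    rw [blockSign_conj htri, add_sub_cancel, smul_smul]; norm_num
  rw [h]
  exact (hpd.add (posDef_blockSign_conj hpd)).smul (by norm_num)

/-- The additive stair preconditioner is congruent, through the inverse of the block diagonal
part, to a sum of two positive definite matrices. -/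
lemma Phiadd_eq {n m : ℕ} {S : Mat n m} (htri : IsBlockTridiag S)
    (hD : IsUnit (blockDiagPart S).det) :
    Phiadd S = (1 / 2 : ℝ) • ((blockDiagPart S)⁻¹ *
      (blockDiagPart S + blockSign n m * S * blockSign n m) * (blockDiagPart S)⁻¹) := by
  have hJD := blockSign_mul_blockDiagPart S
  have hL := inv_add_of_sign hD hJD (stairL_sub_mul_blockSign S) (blockSign_mul_stairL_sub S)
  have hR := inv_add_of_sign (A := stairR S - blockDiagPart S) (J := -blockSign n m) hD
    (by rw [Matrix.neg_mul, Matrix.mul_neg, hJD])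
    (by rw [Matrix.mul_neg, stairR_sub_mul_blockSign, neg_neg])
    (by rw [Matrix.neg_mul, blockSign_mul_stairR_sub])
  rw [add_sub_cancel] at hL hR
  have hsum : blockDiagPart S + ((2 : ℝ) • blockDiagPart S - S)
      = blockDiagPart S + blockDiagPart S
        - (stairL S - blockDiagPart S) - (stairR S - blockDiagPart S) := by
    calc blockDiagPart S + ((2 : ℝ) • blockDiagPart S - S)
        = blockDiagPart S + blockDiagPart S + blockDiagPart S + blockDiagPart S
          - (S + blockDiagPart S) := by rw [two_smul]; abel
      _ = _ := by rw [← stairL_add_stairR htri]; abel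
  rw [Phiadd, hL, hR, blockSign_conj htri, hsum]
  congr 1
  simp only [Matrix.mul_sub, Matrix.sub_mul, Matrix.mul_add, Matrix.add_mul,
    nonsing_inv_mul _ hD, Matrix.one_mul]
  abel

/-- If S is symmetric block tridiagonal positive definite, then the additive
stair preconditioner Φadd⁻¹ is symmetric positive definite. -/
theorem add_preconditioner_posdef {n m : ℕ} (hn : 0 < n) (hm : 0 < m)
    (S : Mat n m) (htri : IsBlockTridiag S) (hpd : S.PosDef) :
    (Phiadd S).IsSymm ∧ (Phiadd S).PosDef := by
  have hDpd := posDef_blockDiagPart htri hpd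
  have hpos : (Phiadd S).PosDef := by
    rw [Phiadd_eq htri hDpd.det_pos.ne'.isUnit]
    refine PosDef.smul ?_ (by norm_num)
    have h := (hDpd.inv.isUnit.posDef_star_left_conjugate_iff).mpr
      (hDpd.add (posDef_blockSign_conj hpd))
    rwa [star_eq_conjTranspose, hDpd.inv.isHermitian.eq] at h
  exact ⟨by simpa using hpos.isHermitian, hpos⟩

end StairPrecond
end
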